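/- (Cauchy integral formula for λ-slice monogenic functions.) Let λ ∈ ℝ, let U ⊆ ℝ^{n+1} be an axially symmetric s-domain, let f ∈ SM_λ(U), let I ∈ 𝕊, and let y ∈ ℂ_I and ρ > 0 be such that the closed Euclidean ball of center y and radius ρ in ℝ^{n+1} is contained in U. Then for every z ∈ ℂ_I with |z − y| < ρ, f(z) = (1/2π) ∫_0^{2π} e^{λ(Re w(θ) − Re z)} (w(θ) − z)^{−1} w′(θ) (−I) f(w(θ)) dθ, where w(θ) := y + ρ(cos θ + I sin θ), w′(θ) := ρ(−sin θ + I cos θ), and the inverse (w(θ) − z)^{−1} is taken in ℂ_I. -/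

import Mathlib

open scoped BigOperators
open Set

noncomputable section

/-- The sphere 𝕊 of (coefficient vectors of) unit 1-vectors in ℝⁿ. -/
def USphere (n : ℕ) : Set (Fin n → ℝ) := {x | ∑ i, x i ^ 2 = 1}

/-- Points of ℝ^{n+1}, written as (x₀, (x₁, …, xₙ)). -/
abbrev Pt (n : ℕ) := ℝ × (Fin n → ℝ)

variable {n : ℕ} {Cl : Type} [NormedRing Cl] [NormedAlgebra ℝ Cl]

/-- The 1-vector of the Clifford algebra with coefficients `x` w.r.t. generators `e`. -/
def vecEmb (e : Fin n → Cl) (x : Fin n → ℝ) : Cl := ∑ i, x i • e i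

/-- The defining relations `eᵢeⱼ + eⱼeᵢ = -2δᵢⱼ` of the Clifford algebra ℝₙ. -/
def CliffordRel (e : Fin n → Cl) : Prop :=
  ∀ i j, e i * e j + e j * e i = if i = j then (-2 : Cl) else 0

/-- The slice Cauchy–Riemann operator `(∂/∂u + I ∂/∂v)` applied to the restriction of `f`
to the slice `ℂ_I`, `I = vecEmb e x`, evaluated at the point `u + I v`. -/
def sliceCR (e : Fin n → Cl) (f : Pt n → Cl) (x : Fin n → ℝ) (u v : ℝ) : Cl :=
  deriv (fun t => f (t, v • x)) u + vecEmb e x * deriv (fun t => f (u, t • x)) v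

/-- λ-slice monogenic functions on `U`. -/
def SMlam (e : Fin n → Cl) (lam : ℝ) (U : Set (Pt n)) (f : Pt n → Cl) : Prop :=
  ContDiffOn ℝ 1 f U ∧
  ∀ x ∈ USphere n, ∀ u v : ℝ, ((u, v • x) : Pt n) ∈ U →
    sliceCR e f x u v + lam • f (u, v • x) = 0

/-- The coordinates (u,v) of the slice `U_I = U ∩ ℂ_I`, `I = vecEmb e x`. -/
def SlicePre (n : ℕ) (U : Set (Pt n)) (x : Fin n → ℝ) : Set (ℝ × ℝ) :=
  {p | ((p.1, p.2 • x) : Pt n) ∈ U}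

/-- Axially symmetric slice domains in ℝ^{n+1}. -/
def AxSymSDomain (n : ℕ) (U : Set (Pt n)) : Prop :=
  IsOpen U ∧ IsConnected U ∧ (∃ u : ℝ, ((u, (0 : Fin n → ℝ)) : Pt n) ∈ U) ∧
  (∀ x ∈ USphere n, IsConnected (SlicePre n U x)) ∧
  ∀ x ∈ USphere n, ∀ y ∈ USphere n, ∀ u v : ℝ,
    ((u, v • x) : Pt n) ∈ U → ((u, v • y) : Pt n) ∈ U

/-- A holomorphic function with values in `ℂ_I`, `I = vecEmb e x`, on a
(relatively open) coordinate set `V`. -/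
def SliceHolo (e : Fin n → Cl) (x : Fin n → ℝ) (V : Set (ℝ × ℝ)) (F : ℝ × ℝ → Cl) : Prop :=
  DifferentiableOn ℝ F V ∧
  (∀ p ∈ V, ∃ a b : ℝ, F p = algebraMap ℝ Cl a + b • vecEmb e x) ∧
  ∀ p ∈ V, deriv (fun t => F (t, p.2)) p.1 + vecEmb e x * deriv (fun t => F (p.1, t)) p.2 = 0

/-- Ordered product `I_A = I_{i₁} ⋯ I_{i_k}` over a finite index set `A`. -/
def IAprod (e : Fin n → Cl) (J : Fin n → Fin n → ℝ) (A : Finset (Fin n)) : Cl :=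
  ((A.sort (· ≤ ·)).map fun i => vecEmb e (J i)).prod

/-- A closed piecewise-C¹ curve parametrized on [0,1]. -/
def PiecewiseC1 (γ : ℝ → ℝ × ℝ) : Prop :=
  ContinuousOn γ (Icc 0 1) ∧
  ∃ (k : ℕ) (t : Fin (k + 1) → ℝ), t 0 = 0 ∧ t (Fin.last k) = 1 ∧ StrictMono t ∧
    ∀ i : Fin k, ContDiffOn ℝ 1 γ (Icc (t i.castSucc) (t i.succ))

/-- `γ` is a closed curve in `V`, homotopic within `V` to a constant curve. -/
def NullHomotopicIn (γ : ℝ → ℝ × ℝ) (V : Set (ℝ × ℝ)) : Prop :=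
  γ 0 = γ 1 ∧ (∀ t ∈ Icc (0:ℝ) 1, γ t ∈ V) ∧
  ∃ (H : ℝ × ℝ → ℝ × ℝ) (p : ℝ × ℝ),
    ContinuousOn H (Icc 0 1 ×ˢ Icc 0 1) ∧
    (∀ q ∈ (Icc (0:ℝ) 1 ×ˢ Icc (0:ℝ) 1), H q ∈ V) ∧
    (∀ t ∈ Icc (0:ℝ) 1, H (0, t) = γ t) ∧
    (∀ t ∈ Icc (0:ℝ) 1, H (1, t) = p) ∧
    (∀ s ∈ Icc (0:ℝ) 1, H (s, 0) = H (s, 1))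

/-- The inverse `(a + bI)⁻¹` computed in the field `ℂ_I`, `I = vecEmb e x`. -/
def sliceInv (e : Fin n → Cl) (x : Fin n → ℝ) (a b : ℝ) : Cl :=
  (a ^ 2 + b ^ 2)⁻¹ • (algebraMap ℝ Cl a - b • vecEmb e x)

/-- The closed Euclidean ball of ℝ^{n+1}. -/
def EucClosedBall (y : Pt n) (ρ : ℝ) : Set (Pt n) :=
  {p | (p.1 - y.1) ^ 2 + ∑ i, (p.2 i - y.2 i) ^ 2 ≤ ρ ^ 2}

/-- Left fractional integral of order `σ` with respect to `g` (with derivative `g'`),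
with base point `aa`. -/
def fracInt (aa σ : ℝ) (g g' : ℝ → ℝ) (φ : ℝ → Cl) (u : ℝ) : Cl :=
  (Real.Gamma σ)⁻¹ • ∫ τ in aa..u, ((g u - g τ) ^ (σ - 1) * g' τ) • φ τ

/-- Right fractional integral of order `σ` with respect to `h` (with derivative `h'`),
with base point `cc`. -/
def fracIntR (cc σ : ℝ) (h h' : ℝ → ℝ) (φ : ℝ → Cl) (v : ℝ) : Cl :=
  (Real.Gamma σ)⁻¹ • ∫ τ in v..cc, ((h τ - h v) ^ (σ - 1) * h' τ) • φ τ

/-- Left Riemann–Liouville fractional derivative of order `al` w.r.t. `g` on `[aa, bb]`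
(one-sided derivatives at the endpoints). -/
def rlD (aa bb al : ℝ) (g g' : ℝ → ℝ) (φ : ℝ → Cl) (u : ℝ) : Cl :=
  (g' u)⁻¹ • derivWithin (fracInt aa (1 - al) g g' φ) (Icc aa bb) u

/-- The set `S_{a,b,c} ⊆ ℝ^{n+1}`. -/
def Sabc (n : ℕ) (a b c : ℝ) : Set (Pt n) :=
  {p | ∃ x ∈ USphere n, ∃ u ∈ Icc a b, ∃ v ∈ Icc 0 c, p = ((u, v • x) : Pt n)}

/-- Absolutely continuous function on `[a,b]`. -/
def AbsContOn {E : Type} [NormedAddCommGroup E] (φ : ℝ → E) (a b : ℝ) : Prop :=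
  ∀ ε > (0:ℝ), ∃ δ > (0:ℝ), ∀ (k : ℕ) (p q : Fin k → ℝ),
    (∀ i, p i ∈ Icc a b ∧ q i ∈ Icc a b ∧ p i ≤ q i) →
    (∀ i j, i ≠ j → Ioo (p i) (q i) ∩ Ioo (p j) (q j) = ∅) →
    (∑ i, (q i - p i)) < δ → (∑ i, ‖φ (q i) - φ (p i)‖) < ε

/-- The class `AC¹(S_{a,b,c}, ℝₙ)`. -/
def AC1 (a b c r s : ℝ) (f : Pt n → Cl) : Prop :=
  ContinuousOn f (Sabc n a b c) ∧
  ∀ x ∈ USphere n,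
    AbsContOn (fun u => f (u, s • x)) a b ∧ AbsContOn (fun v => f (r, v • x)) 0 c

/-- `A_I(u) = (I_{a+}^{1-α,g}[τ ↦ f(τ + Is)])(u)`, where `I = vecEmb e x`. -/
def AIfun (a al s : ℝ) (g g' : ℝ → ℝ) (f : Pt n → Cl) (x : Fin n → ℝ) : ℝ → Cl :=
  fracInt a (1 - al) g g' fun τ => f (τ, s • x)

/-- `B_I(v) = (I_{0+}^{1-β,h}[τ ↦ f(r + Iτ)])(v)`, where `I = vecEmb e x`. -/
def BIfun (be r : ℝ) (h h' : ℝ → ℝ) (f : Pt n → Cl) (x : Fin n → ℝ) : ℝ → Cl :=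
  fracInt 0 (1 - be) h h' fun τ => f (r, τ • x)

/-- `B_I^{c-}(v) = (I_{c-}^{1-β,h}[τ ↦ f(r + Iτ)])(v)`, where `I = vecEmb e x`. -/
def BIcfun (c be r : ℝ) (h h' : ℝ → ℝ) (f : Pt n → Cl) (x : Fin n → ℝ) : ℝ → Cl :=
  fracIntR c (1 - be) h h' fun τ => f (r, τ • x)

/-- Condition (m1): the maps `A_I` and `B_I` are of class C¹ for every `I ∈ 𝕊`. -/
def M1 (a b c al be r s : ℝ) (g g' h h' : ℝ → ℝ) (f : Pt n → Cl) : Prop :=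
  ∀ x ∈ USphere n,
    ContDiffOn ℝ 1 (AIfun a al s g g' f x) (Icc a b) ∧
    ContDiffOn ℝ 1 (BIfun be r h h' f x) (Icc 0 c)

/-- Riemann–Liouville fractional slice monogenic functions of order `(α,β)`
with respect to `(g,h)` on `S_{a,b,c}`. -/
def RLSM (a b c al be r s : ℝ) (g g' h h' : ℝ → ℝ) (e : Fin n → Cl) (f : Pt n → Cl) : Prop :=
  AC1 a b c r s f ∧ M1 a b c al be r s g g' h h' f ∧
  ∀ x ∈ USphere n, ∀ u ∈ Icc a b, ∀ v ∈ Icc 0 c,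
    (g' u)⁻¹ • derivWithin (AIfun a al s g g' f x) (Icc a b) u +
      vecEmb e x * ((h' v)⁻¹ • derivWithin (BIfun be r h h' f x) (Icc 0 c) v) = 0

theorem vecEmb_mul_self {e : Fin n → Cl} (he : CliffordRel e) {x : Fin n → ℝ}
    (hx : x ∈ USphere n) : vecEmb e x * vecEmb e x = -1 := by
  have hsum : vecEmb e x * vecEmb e x = ∑ i, ∑ j, (x i * x j) • (e i * e j) := by
    simp only [vecEmb, Finset.sum_mul_sum, smul_mul_smul_comm]
  have hswap : vecEmb e x * vecEmb e x = ∑ i, ∑ j, (x i * x j) • (e j * e i) := by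
    rw [hsum, Finset.sum_comm]
    simp only [mul_comm]
  have hdouble : vecEmb e x * vecEmb e x + vecEmb e x * vecEmb e x = (2 : ℝ) • (-1 : Cl) := by
    nth_rewrite 1 [hsum]
    rw [hswap]
    simp only [← Finset.sum_add_distrib, ← smul_add, he _ _, smul_ite, smul_zero,
      Finset.sum_ite_eq, Finset.mem_univ, if_true]
    rw [← Finset.sum_smul]
    have : ∑ i, x i * x i = 1 := by simpa [USphere, sq] using hx
    rw [this, one_smul, two_smul]
    norm_num
  rw [← two_smul ℝ] at hdouble
  exact smul_right_injective Cl (two_ne_zero' ℝ) hdouble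

/-- The complex functional `m ↦ ℓ m - i ℓ (J m)` attached to a real functional `ℓ`; it is
`ℂ`-linear for the complex structure given by left multiplication by `J` when `J² = -1`. -/
def complexify (J : Cl) (l : StrongDual ℝ Cl) : Cl →L[ℝ] ℂ :=
  Complex.ofRealCLM.comp l -
    Complex.I • Complex.ofRealCLM.comp (l.comp (ContinuousLinearMap.mul ℝ Cl J))

theorem complexify_apply (J : Cl) (l : StrongDual ℝ Cl) (m : Cl) :
    complexify J l m = l m - Complex.I * l (J * m) := by
  simp [complexify]

theorem complexify_re (J : Cl) (l : StrongDual ℝ Cl) (m : Cl) :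
    (complexify J l m).re = l m := by
  simp [complexify_apply]

theorem complexify_mul {J : Cl} (hJ : J * J = -1) (l : StrongDual ℝ Cl) (m : Cl) :
    complexify J l (J * m) = Complex.I * complexify J l m := by
  simp only [complexify_apply, ← mul_assoc, hJ, neg_mul, one_mul, map_neg, Complex.ofReal_neg,
    mul_sub, Complex.I_mul_I]
  ring

theorem complexify_slice_mul {J : Cl} (hJ : J * J = -1) (l : StrongDual ℝ Cl) (a b : ℝ)
    (m : Cl) : complexify J l ((a • (1 : Cl) + b • J) * m) =
      (a + b * Complex.I) * complexify J l m := by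
  simp only [add_mul, smul_mul_assoc, one_mul, map_add, map_smul, complexify_mul hJ,
    Complex.real_smul, mul_assoc]

theorem complexify_sliceInv_mul {e : Fin n → Cl} {x : Fin n → ℝ}
    (hJ : vecEmb e x * vecEmb e x = -1) (l : StrongDual ℝ Cl) (a b : ℝ) (m : Cl) :
    complexify (vecEmb e x) l (sliceInv e x a b * m) =
      (a + b * Complex.I)⁻¹ * complexify (vecEmb e x) l m := by
  rw [sliceInv, Algebra.algebraMap_eq_smul_one, sub_eq_add_neg, ← neg_smul, smul_mul_assoc,
    map_smul, complexify_slice_mul hJ, Complex.inv_def, Complex.normSq_add_mul_I]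
  simp only [map_add, map_mul, Complex.conj_ofReal, Complex.conj_I, Complex.real_smul,
    Complex.ofReal_neg]
  ring

theorem eq_of_complexify_eq (J : Cl) {a b : Cl}
    (h : ∀ l : StrongDual ℝ Cl, complexify J l a = complexify J l b) : a = b := by
  refine (SeparatingDual.eq_iff_forall_dual_eq (R := ℝ)).2 fun l => ?_
  rw [← complexify_re J, h, complexify_re]

theorem mem_EucClosedBall_slice {x : Fin n → ℝ} (hx : x ∈ USphere n) {y₁ y₂ ρ u v : ℝ} :
    ((u, v • x) : Pt n) ∈ EucClosedBall ((y₁, y₂ • x) : Pt n) ρ ↔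
      (u - y₁) ^ 2 + (v - y₂) ^ 2 ≤ ρ ^ 2 := by
  have h : ∑ i, (v * x i - y₂ * x i) ^ 2 = (v - y₂) ^ 2 := by
    simp only [← sub_mul, mul_pow, ← Finset.mul_sum]
    rw [show ∑ i, x i ^ 2 = 1 from hx, mul_one]
  simp [EucClosedBall, h]

/-- On a slice, a `λ`-slice monogenic function becomes holomorphic after multiplication by
`exp (λ Re z)` and composition with `complexify`. -/
theorem SMlam.differentiableAt_complexify {e : Fin n → Cl} (he : CliffordRel e) {lam : ℝ}
    {U : Set (Pt n)} (hU : IsOpen U) {f : Pt n → Cl} (hf : SMlam e lam U f)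
    {x : Fin n → ℝ} (hx : x ∈ USphere n) (l : StrongDual ℝ Cl) {z : ℂ}
    (hz : ((z.re, z.im • x) : Pt n) ∈ U) :
    DifferentiableAt ℂ (fun w : ℂ =>
      (Real.exp (lam * w.re)) • complexify (vecEmb e x) l (f (w.re, w.im • x))) z := by
  have hJ := vecEmb_mul_self he hx
  have hd : DifferentiableAt ℝ f (z.re, z.im • x) :=
    (hf.1.differentiableOn (by norm_num)).differentiableAt (hU.mem_nhds hz)
  have hD := hd.hasFDerivAt
  set D := fderiv ℝ f (z.re, z.im • x)
  have hu : HasDerivAt (fun t : ℝ => f (t, z.im • x)) (D (1, 0)) z.re :=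
    HasFDerivAt.comp_hasDerivAt (f := fun t : ℝ => ((t, z.im • x) : Pt n)) z.re hD
      ((hasDerivAt_id _).prodMk (hasDerivAt_const _ _))
  have hv : HasDerivAt (fun t : ℝ => f (z.re, t • x)) (D (0, x)) z.im := by
    refine HasFDerivAt.comp_hasDerivAt (f := fun t : ℝ => ((z.re, t • x) : Pt n)) z.im hD ?_
    simpa using (hasDerivAt_const _ _).prodMk ((hasDerivAt_id z.im).smul_const x)
  have hCR := hf.2 x hx z.re z.im hz
  rw [sliceCR, hu.deriv, hv.deriv] at hCR
  replace hCR := congrArg (complexify (vecEmb e x) l) hCR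
  simp only [map_add, map_smul, complexify_mul hJ, map_zero] at hCR
  have hslice : HasFDerivAt (fun w : ℂ => ((w.re, w.im • x) : Pt n))
      (Complex.reCLM.prod (Complex.imCLM.smulRight x)) z :=
    (Complex.reCLM.prod (Complex.imCLM.smulRight x)).hasFDerivAt
  have hL : HasFDerivAt (fun w : ℂ => complexify (vecEmb e x) l (f (w.re, w.im • x))) _ z :=
    (complexify (vecEmb e x) l).hasFDerivAt.comp z (hD.comp z hslice)
  have hE : HasFDerivAt (fun w : ℂ => Real.exp (lam * w.re)) _ z :=
    (Complex.reCLM.hasFDerivAt.const_mul lam).exp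
  have hk := hE.smul hL
  rw [differentiableAt_complex_iff_differentiableAt_real]
  refine ⟨hk.differentiableAt, ?_⟩
  have hk' := hk.fderiv
  rw [show (fun w : ℂ => Real.exp (lam * w.re)) • _ = fun w : ℂ =>
    Real.exp (lam * w.re) • complexify (vecEmb e x) l (f (w.re, w.im • x)) from rfl] at hk'
  rw [hk']
  simp only [add_apply, smul_apply,
    ContinuousLinearMap.comp_apply, ContinuousLinearMap.prod_apply, Complex.reCLM_apply,
    Complex.imCLM_apply, ContinuousLinearMap.smulRight_apply, Complex.I_re, Complex.I_im,
    Complex.one_re, Complex.one_im, one_smul, zero_smul, add_zero, smul_eq_mul,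
    Complex.real_smul, mul_one, mul_zero, Complex.ofReal_mul] at hCR ⊢
  linear_combination (-Complex.I * Real.exp (lam * z.re)) * hCR +
    Real.exp (lam * z.re) * complexify (vecEmb e x) l (D (0, x)) * Complex.I_mul_I

/-- Cauchy integral formula for λ-slice monogenic functions. -/
theorem statement4 [CompleteSpace Cl] (e : Fin n → Cl) (he : CliffordRel e) (lam : ℝ)
    (U : Set (Pt n)) (hU : AxSymSDomain n U) (f : Pt n → Cl) (hf : SMlam e lam U f)
    (x : Fin n → ℝ) (hx : x ∈ USphere n)
    (y₁ y₂ ρ : ℝ) (hρ : 0 < ρ)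
    (hball : EucClosedBall ((y₁, y₂ • x) : Pt n) ρ ⊆ U)
    (u v : ℝ) (hz : (u - y₁) ^ 2 + (v - y₂) ^ 2 < ρ ^ 2) :
    f (u, v • x)
      = (2 * Real.pi)⁻¹ • ∫ θ in (0:ℝ)..(2 * Real.pi),
          Real.exp (lam * ((y₁ + ρ * Real.cos θ) - u)) •
            (sliceInv e x (y₁ + ρ * Real.cos θ - u) (y₂ + ρ * Real.sin θ - v) *
              ((ρ * (-Real.sin θ)) • (1 : Cl) + (ρ * Real.cos θ) • vecEmb e x) *
              (-(vecEmb e x)) *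
              f (y₁ + ρ * Real.cos θ, (y₂ + ρ * Real.sin θ) • x)) := by
  have hJ := vecEmb_mul_self he hx
  have hin : ∀ {a b : ℝ}, (a - y₁) ^ 2 + (b - y₂) ^ 2 ≤ ρ ^ 2 → ((a, b • x) : Pt n) ∈ U :=
    fun h => hball ((mem_EucClosedBall_slice hx).2 h)
  have hcircle : ∀ θ : ℝ,
      ((y₁ + ρ * Real.cos θ, (y₂ + ρ * Real.sin θ) • x) : Pt n) ∈ U := fun θ => hin <| by
    nlinarith [Real.sin_sq_add_cos_sq θ]
  have hne : ∀ θ : ℝ,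
      (y₁ + ρ * Real.cos θ - u) ^ 2 + (y₂ + ρ * Real.sin θ - v) ^ 2 ≠ 0 := fun θ h => by
    have h₁ : y₁ + ρ * Real.cos θ - u = 0 := by nlinarith
    have h₂ : y₂ + ρ * Real.sin θ - v = 0 := by nlinarith
    have h₃ : u - y₁ = ρ * Real.cos θ := by linarith
    have h₄ : v - y₂ = ρ * Real.sin θ := by linarith
    rw [h₃, h₄] at hz
    nlinarith [Real.sin_sq_add_cos_sq θ]
  have hcont : Continuous fun θ : ℝ =>
      f (y₁ + ρ * Real.cos θ, (y₂ + ρ * Real.sin θ) • x) :=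
    hf.1.continuousOn.comp_continuous (by fun_prop) hcircle
  refine eq_of_complexify_eq (vecEmb e x) fun l => ?_
  set L := complexify (vecEmb e x) l with hLdef
  rw [map_smul, ← L.intervalIntegral_comp_comm]
  swap
  · refine Continuous.intervalIntegrable ?_ _ _
    have hinv : Continuous fun θ : ℝ =>
        ((y₁ + ρ * Real.cos θ - u) ^ 2 + (y₂ + ρ * Real.sin θ - v) ^ 2)⁻¹ :=
      Continuous.inv₀ (by fun_prop) hne
    have hsliceInv : Continuous fun θ : ℝ =>
        sliceInv e x (y₁ + ρ * Real.cos θ - u) (y₂ + ρ * Real.sin θ - v) := by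
      simp only [sliceInv, Algebra.algebraMap_eq_smul_one]
      exact hinv.smul (by fun_prop)
    exact Continuous.smul (by fun_prop)
      (((hsliceInv.mul (by fun_prop)).mul continuous_const).mul hcont)
  set g : ℂ → ℂ := fun w => (Real.exp (lam * w.re)) • L (f (w.re, w.im • x)) with hg
  have hnorm : ∀ w : ℂ, ‖w - (⟨y₁, y₂⟩ : ℂ)‖ ^ 2 = (w.re - y₁) ^ 2 + (w.im - y₂) ^ 2 := fun w => by
    rw [Complex.sq_norm, Complex.normSq_apply]
    simp [sq]
  have hdiff : DifferentiableOn ℂ g (Metric.closedBall (⟨y₁, y₂⟩ : ℂ) ρ) := fun w hw => by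
    refine (hf.differentiableAt_complexify he hU.1 hx l (hin ?_)).differentiableWithinAt
    rw [← hnorm]
    exact pow_le_pow_left₀ (norm_nonneg _) (mem_closedBall_iff_norm.1 hw) 2
  have hzmem : (⟨u, v⟩ : ℂ) ∈ Metric.ball (⟨y₁, y₂⟩ : ℂ) ρ := by
    rw [mem_ball_iff_norm]
    refine lt_of_pow_lt_pow_left₀ 2 hρ.le ?_
    rw [hnorm]
    exact hz
  have hC := hdiff.circleIntegral_sub_inv_smul hzmem
  have hmap : ∀ θ : ℝ, circleMap (⟨y₁, y₂⟩ : ℂ) ρ θ =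
      ⟨y₁ + ρ * Real.cos θ, y₂ + ρ * Real.sin θ⟩ := fun θ => by
    apply Complex.ext <;> simp [circleMap, Complex.exp_ofReal_mul_I_re, Complex.exp_ofReal_mul_I_im]
  have hintegrand : ∀ θ : ℝ, L (Real.exp (lam * ((y₁ + ρ * Real.cos θ) - u)) •
      (sliceInv e x (y₁ + ρ * Real.cos θ - u) (y₂ + ρ * Real.sin θ - v) *
        ((ρ * (-Real.sin θ)) • (1 : Cl) + (ρ * Real.cos θ) • vecEmb e x) *
        (-(vecEmb e x)) * f (y₁ + ρ * Real.cos θ, (y₂ + ρ * Real.sin θ) • x))) =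
      (-Complex.I * Real.exp (-(lam * u))) * (deriv (circleMap (⟨y₁, y₂⟩ : ℂ) ρ) θ •
        (circleMap (⟨y₁, y₂⟩ : ℂ) ρ θ - ⟨u, v⟩)⁻¹ • g (circleMap (⟨y₁, y₂⟩ : ℂ) ρ θ)) := fun θ => by
    have hderiv : deriv (circleMap (⟨y₁, y₂⟩ : ℂ) ρ) θ =
        ((ρ * (-Real.sin θ) : ℝ) : ℂ) + ((ρ * Real.cos θ : ℝ) : ℂ) * Complex.I := by
      rw [deriv_circleMap]
      apply Complex.ext <;>
        simp [circleMap, Complex.exp_ofReal_mul_I_re, Complex.exp_ofReal_mul_I_im,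
          Complex.cos_ofReal_re, Complex.sin_ofReal_re]
    have hsub : circleMap (⟨y₁, y₂⟩ : ℂ) ρ θ - ⟨u, v⟩ =
        ((y₁ + ρ * Real.cos θ - u : ℝ) : ℂ) +
          ((y₂ + ρ * Real.sin θ - v : ℝ) : ℂ) * Complex.I := by
      rw [hmap]
      apply Complex.ext <;> simp [Complex.cos_ofReal_re, Complex.sin_ofReal_re]
    rw [hderiv, hsub, hmap, map_smul, mul_assoc, mul_assoc, hLdef, complexify_sliceInv_mul hJ,
      complexify_slice_mul hJ, neg_mul, map_neg, complexify_mul hJ, mul_sub, sub_eq_add_neg,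
      Real.exp_add]
    simp only [hg, hLdef, smul_eq_mul, Complex.real_smul, Complex.ofReal_mul]
    ring
  simp only [hintegrand]
  rw [intervalIntegral.integral_const_mul]
  rw [circleIntegral] at hC
  rw [hC]
  have hpi : (Real.pi : ℂ) ≠ 0 := Complex.ofReal_ne_zero.2 Real.pi_ne_zero
  have hexp : (Real.exp (-(lam * u)) : ℂ) * Real.exp (lam * u) = 1 := by
    rw [← Complex.ofReal_mul, ← Real.exp_add, neg_add_cancel, Real.exp_zero, Complex.ofReal_one]
  simp only [hg, smul_eq_mul, Complex.real_smul, Complex.ofReal_inv, Complex.ofReal_mul,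
    Complex.ofReal_ofNat]
  field_simp
  linear_combination (L (f (u, v • x)) * Complex.I ^ 2) * hexp + L (f (u, v • x)) * Complex.I_sq
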